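/- (Hardy–Sobolev inequality) Let N and k be integers with 2 ≤ k ≤ N, and write each point x ∈ ℝ^N as x = (y, z) with y ∈ ℝ^k and z ∈ ℝ^{N−k}. Let n and β be real numbers with 1 < n < N, 0 ≤ β ≤ n and β < k, and set γ = n(N−β)/(N−n). Then there exists a constant C > 0, depending only on β, n, N and k, such that for every smooth compactly supported function u : ℝ^N → ℝ one has ∫_{ℝ^N} |u(x)|^γ / |y|^β dx ≤ C · (∫_{ℝ^N} ‖∇u(x)‖^n dx)^{(N−β)/(N−n)}. -/

import Mathlib

open MeasureTheory

noncomputable def wt (N k : ℕ) (hkN : k ≤ N) (ε : ℝ) (x : EuclideanSpace ℝ (Fin N)) : ℝ :=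
  ∑ i : Fin k, x (Fin.castLE hkN i) ^ 2 + ε

lemma wt_pos {N k : ℕ} (hkN : k ≤ N) {ε : ℝ} (hε : 0 < ε) (x : EuclideanSpace ℝ (Fin N)) :
    0 < wt N k hkN ε x := by
  unfold wt; positivity

lemma wt_hasFDerivAt {N k : ℕ} (hkN : k ≤ N) (ε : ℝ) (x : EuclideanSpace ℝ (Fin N)) :
    HasFDerivAt (wt N k hkN ε) (∑ i : Fin k, (2 * x (Fin.castLE hkN i)) •
      (EuclideanSpace.proj (Fin.castLE hkN i) : EuclideanSpace ℝ (Fin N) →L[ℝ] ℝ)) x := by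
  unfold wt
  refine HasFDerivAt.add_const ε (HasFDerivAt.fun_sum fun i _ => ?_)
  have h := ((EuclideanSpace.proj (Fin.castLE hkN i) : EuclideanSpace ℝ (Fin N) →L[ℝ] ℝ).hasFDerivAt (x := x)).pow 2
  simpa using h

lemma wt_continuous {N k : ℕ} (hkN : k ≤ N) (ε : ℝ) : Continuous (wt N k hkN ε) := by
  unfold wt; fun_prop

lemma field_hasFDerivAt {N k : ℕ} (hkN : k ≤ N) {ε : ℝ} (hε : 0 < ε) (s : ℝ) (j : Fin k)
    (x : EuclideanSpace ℝ (Fin N)) :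
    HasFDerivAt (fun x => x (Fin.castLE hkN j) * wt N k hkN ε x ^ (-s/2))
      (x (Fin.castLE hkN j) • (((-s/2) * wt N k hkN ε x ^ (-s/2 - 1)) •
        ∑ i : Fin k, (2 * x (Fin.castLE hkN i)) •
      (EuclideanSpace.proj (Fin.castLE hkN i) : EuclideanSpace ℝ (Fin N) →L[ℝ] ℝ)) +
      wt N k hkN ε x ^ (-s/2) • (EuclideanSpace.proj (Fin.castLE hkN j) : EuclideanSpace ℝ (Fin N) →L[ℝ] ℝ)) x := by
  have h := ((EuclideanSpace.proj (Fin.castLE hkN j) : EuclideanSpace ℝ (Fin N) →L[ℝ] ℝ).hasFDerivAt (x := x)).mul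
    ((wt_hasFDerivAt hkN ε x).rpow_const (p := -s/2) (Or.inl (wt_pos hkN hε x).ne'))
  exact h

lemma field_fderiv {N k : ℕ} (hkN : k ≤ N) {ε : ℝ} (hε : 0 < ε) (s : ℝ) (j : Fin k)
    (x : EuclideanSpace ℝ (Fin N)) :
    fderiv ℝ (fun x => x (Fin.castLE hkN j) * wt N k hkN ε x ^ (-s/2)) x
      (EuclideanSpace.single (Fin.castLE hkN j) 1) =
      wt N k hkN ε x ^ (-s/2) - s * wt N k hkN ε x ^ (-s/2 - 1) * x (Fin.castLE hkN j) ^ 2 := by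
  rw [(field_hasFDerivAt hkN hε s j x).fderiv]
  simp
  ring
lemma abs_rpow_hasFDerivAt {N : ℕ} {u : EuclideanSpace ℝ (Fin N) → ℝ} (hu : ContDiff ℝ 1 u) {γ : ℝ}
    (hγ : 1 < γ) (x : EuclideanSpace ℝ (Fin N)) : HasFDerivAt (fun x => |u x| ^ γ) ((γ * |u x| ^ (γ - 2) * u x) • fderiv ℝ u x) x := by
  exact (hasDerivAt_abs_rpow (u x) hγ).comp_hasFDerivAt x ((hu.differentiable (by simp)) x).hasFDerivAt

lemma radial_bound {N k : ℕ} (hkN : k ≤ N) {ε : ℝ} (hε : 0 < ε)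
    (L : EuclideanSpace ℝ (Fin N) →L[ℝ] ℝ) (x : EuclideanSpace ℝ (Fin N)) :
    |∑ j : Fin k, L (EuclideanSpace.single (Fin.castLE hkN j) 1) * x (Fin.castLE hkN j)| ≤
      ‖L‖ * wt N k hkN ε x ^ (1/2 : ℝ) := by
  have ho : Orthonormal ℝ (fun j : Fin k =>
      (EuclideanSpace.single (Fin.castLE hkN j) (1:ℝ) : EuclideanSpace ℝ (Fin N))) :=
    (EuclideanSpace.orthonormal_single (𝕜 := ℝ) (ι := Fin N)).comp _ (Fin.castLE_injective hkN)
  set v : EuclideanSpace ℝ (Fin N) := ∑ j : Fin k, x (Fin.castLE hkN j) •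
    (EuclideanSpace.single (Fin.castLE hkN j) (1:ℝ) : EuclideanSpace ℝ (Fin N)) with hv
  have h1 : ∑ j : Fin k, L (EuclideanSpace.single (Fin.castLE hkN j) 1) * x (Fin.castLE hkN j)
      = L v := by
    simp only [hv, map_sum, map_smul, smul_eq_mul]
    exact Finset.sum_congr rfl fun j _ => mul_comm _ _
  have h2 : ‖v‖ ^ 2 = ∑ j : Fin k, x (Fin.castLE hkN j) ^ 2 := by
    rw [← real_inner_self_eq_norm_sq, hv, ho.inner_sum]
    exact Finset.sum_congr rfl fun j _ => by simp [sq]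
  have h3 : ‖v‖ ≤ wt N k hkN ε x ^ (1/2 : ℝ) := by
    rw [← Real.sqrt_eq_rpow]
    apply Real.le_sqrt_of_sq_le
    rw [h2, wt]; linarith
  rw [h1, ← Real.norm_eq_abs]
  exact (L.le_opNorm v).trans (by gcongr)

lemma hardy_core {N k : ℕ} (hkN : k ≤ N) {ε : ℝ} (hε : 0 < ε) {s γ : ℝ} (hs : 1 ≤ s)
    (hγ : 1 < γ) {u : EuclideanSpace ℝ (Fin N) → ℝ} (hu : ContDiff ℝ 1 u)
    (hc : HasCompactSupport u) :
    (k - s) * ∫ x, |u x| ^ γ * wt N k hkN ε x ^ (-s/2) ≤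
      γ * ∫ x, |u x| ^ (γ - 1) * ‖fderiv ℝ u x‖ * wt N k hkN ε x ^ (-(s-1)/2) := by
  have hwc := wt_continuous hkN ε
  have hwp := fun x => wt_pos hkN hε x
  have hwr : ∀ p : ℝ, Continuous fun x => wt N k hkN ε x ^ p := fun p =>
    hwc.rpow_const fun x => Or.inl (hwp x).ne'
  have huc := hu.continuous
  have hduc : Continuous (fderiv ℝ u) := hu.continuous_fderiv (by simp)
  have hint : ∀ h : EuclideanSpace ℝ (Fin N) → ℝ, Continuous h → (∀ x, u x = 0 → h x = 0) →
      Integrable h := by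
    intro h hh h0
    refine hh.integrable_of_hasCompactSupport (hc.mono ?_)
    intro x hx hx'
    exact hx (h0 x hx')
  have hf1 : ContDiff ℝ 1 (fun x => |u x| ^ γ) := by simpa using hu.norm_rpow hγ
  have hfd : ∀ x, fderiv ℝ (fun x => |u x| ^ γ) x = (γ * |u x| ^ (γ - 2) * u x) • fderiv ℝ u x :=
    fun x => (abs_rpow_hasFDerivAt hu hγ x).fderiv
  have hfdc : Continuous (fderiv ℝ (fun x => |u x| ^ γ)) := hf1.continuous_fderiv (by simp)
  have hf0 : ∀ x, u x = 0 → |u x| ^ γ = 0 := fun x hx => by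
    rw [hx, abs_zero, Real.zero_rpow (by linarith)]
  have i1 : ∀ j : Fin k, Integrable (fun x => fderiv ℝ (fun x => |u x| ^ γ) x
      (EuclideanSpace.single (Fin.castLE hkN j) 1) *
      (x (Fin.castLE hkN j) * wt N k hkN ε x ^ (-s/2))) := by
    intro j
    refine hint _ ?_ ?_
    · exact (hfdc.clm_apply continuous_const).mul ((by fun_prop : Continuous fun x : EuclideanSpace ℝ (Fin N) => x (Fin.castLE hkN j)).mul (hwr _))
    · intro x hx
      simp [hfd, hx]
  have i2 : ∀ j : Fin k, Integrable (fun x => |u x| ^ γ *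
      fderiv ℝ (fun x => x (Fin.castLE hkN j) * wt N k hkN ε x ^ (-s/2)) x
      (EuclideanSpace.single (Fin.castLE hkN j) 1)) := by
    intro j
    refine hint _ ?_ ?_
    · simp_rw [field_fderiv hkN hε]
      have := hf1.continuous
      have := hwr (-s/2)
      have := hwr (-s/2-1)
      fun_prop
    · intro x hx
      rw [hf0 x hx, zero_mul]
  have ibp : ∀ j : Fin k, ∫ x, |u x| ^ γ *
      fderiv ℝ (fun x => x (Fin.castLE hkN j) * wt N k hkN ε x ^ (-s/2)) x
      (EuclideanSpace.single (Fin.castLE hkN j) 1) = - ∫ x, fderiv ℝ (fun x => |u x| ^ γ) x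
      (EuclideanSpace.single (Fin.castLE hkN j) 1) *
      (x (Fin.castLE hkN j) * wt N k hkN ε x ^ (-s/2)) := by
    intro j
    refine integral_mul_fderiv_eq_neg_fderiv_mul_of_integrable (i1 j) (i2 j) ?_ ?_ ?_
    · refine hint _ ?_ ?_
      · exact hf1.continuous.mul ((by fun_prop : Continuous fun x : EuclideanSpace ℝ (Fin N) => x (Fin.castLE hkN j)).mul (hwr _))
      · intro x hx
        rw [hf0 x hx, zero_mul]
    · intro x _
      exact (abs_rpow_hasFDerivAt hu hγ x).differentiableAt
    · intro x _
      exact (field_hasFDerivAt hkN hε s j x).differentiableAt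
  rw [← integral_const_mul, ← integral_const_mul]
  calc ∫ x, (k - s) * (|u x| ^ γ * wt N k hkN ε x ^ (-s/2))
      ≤ ∫ x, ∑ j : Fin k, |u x| ^ γ *
          fderiv ℝ (fun x => x (Fin.castLE hkN j) * wt N k hkN ε x ^ (-s/2)) x
          (EuclideanSpace.single (Fin.castLE hkN j) 1) := by
        refine integral_mono ?_ (integrable_finsetSum _ fun j _ => i2 j) ?_
        · refine (hint _ (hf1.continuous.mul (hwr _)) ?_).const_mul _
          intro x hx
          change |u x| ^ γ * _ = 0
          rw [hf0 x hx, zero_mul]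
        · intro x
          simp_rw [field_fderiv hkN hε]
          rw [← Finset.mul_sum, Finset.sum_sub_distrib, ← Finset.mul_sum]
          simp only [Finset.sum_const, Finset.card_univ, Fintype.card_fin, nsmul_eq_mul]
          have e1 : ∑ i : Fin k, x (Fin.castLE hkN i) ^ 2 = wt N k hkN ε x - ε := by
            rw [wt]; ring
          have e2 : wt N k hkN ε x ^ (-s/2) = wt N k hkN ε x ^ (-s/2-1) * wt N k hkN ε x := by
            rw [← Real.rpow_add_one (hwp x).ne']; ring_nf
          rw [e1, e2]
          have p1 : 0 ≤ |u x| ^ γ := by positivity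
          have p2 : 0 ≤ wt N k hkN ε x ^ (-s/2-1) := (Real.rpow_pos_of_pos (hwp x) _).le
          have : 0 ≤ |u x| ^ γ * (s * wt N k hkN ε x ^ (-s/2-1) * ε) := by positivity
          linarith
    _ = ∑ j : Fin k, ∫ x, |u x| ^ γ *
          fderiv ℝ (fun x => x (Fin.castLE hkN j) * wt N k hkN ε x ^ (-s/2)) x
          (EuclideanSpace.single (Fin.castLE hkN j) 1) := integral_finsetSum _ fun j _ => i2 j
    _ = ∫ x, -∑ j : Fin k, fderiv ℝ (fun x => |u x| ^ γ) x
          (EuclideanSpace.single (Fin.castLE hkN j) 1) *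
          (x (Fin.castLE hkN j) * wt N k hkN ε x ^ (-s/2)) := by
        rw [integral_neg, integral_finsetSum _ fun j _ => i1 j, ← Finset.sum_neg_distrib]
        exact Finset.sum_congr rfl fun j _ => ibp j
    _ ≤ _ := by
        refine integral_mono (integrable_finsetSum _ fun j _ => i1 j).neg ?_ ?_
        · refine (hint _ ?_ ?_).const_mul _
          · exact ((huc.abs.rpow_const fun x => Or.inr (by linarith)).mul hduc.norm).mul (hwr _)
          · intro x hx
            simp only [hx, abs_zero, Real.zero_rpow (by linarith : γ - 1 ≠ 0), zero_mul]
        · intro x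
          dsimp only
          refine (le_abs_self _).trans ?_
          rw [abs_neg]
          have e : ∑ j : Fin k, fderiv ℝ (fun x => |u x| ^ γ) x
            (EuclideanSpace.single (Fin.castLE hkN j) 1) *
            (x (Fin.castLE hkN j) * wt N k hkN ε x ^ (-s/2)) =
            (γ * (|u x| ^ (γ - 2) * u x)) * wt N k hkN ε x ^ (-s/2) *
            ∑ j : Fin k, fderiv ℝ u x (EuclideanSpace.single (Fin.castLE hkN j) 1) *
              x (Fin.castLE hkN j) := by
            rw [hfd, Finset.mul_sum]
            refine Finset.sum_congr rfl fun j _ => ?_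
            simp only [smul_apply, smul_eq_mul]
            ring
          have e3 : |u x| ^ (γ - 2) * |u x| = |u x| ^ (γ - 1) := by
            by_cases hx : u x = 0
            · simp only [hx, abs_zero, Real.zero_rpow (by linarith : γ - 1 ≠ 0), mul_zero]
            · rw [← Real.rpow_add_one (by positivity)]; ring_nf
          have p2 : 0 ≤ wt N k hkN ε x ^ (-s/2) := (Real.rpow_pos_of_pos (hwp x) _).le
          have e4 : wt N k hkN ε x ^ (-(s-1)/2) =
              wt N k hkN ε x ^ (-s/2) * wt N k hkN ε x ^ (1/2:ℝ) := by
            rw [← Real.rpow_add (hwp x)]; ring_nf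
          rw [e, abs_mul, abs_mul, abs_mul, abs_mul, abs_of_nonneg p2, abs_of_nonneg (by positivity : 0 ≤ |u x| ^ (γ - 2)), e3, e4,
            abs_of_pos (by linarith : 0 < γ)]
          calc _ ≤ γ * |u x| ^ (γ - 1) * wt N k hkN ε x ^ (-s/2) *
                (‖fderiv ℝ u x‖ * wt N k hkN ε x ^ (1/2 : ℝ)) := by
                gcongr
                exact radial_bound hkN hε _ x
            _ = _ := by ring

lemma hardy_step {N k : ℕ} (hkN : k ≤ N) {ε : ℝ} (hε : 0 < ε) {s n : ℝ} (hs : 1 ≤ s)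
    (hsn : s ≤ n) (hn1 : 1 < n) (hnN : n < N) (hsk : s < k)
    {u : EuclideanSpace ℝ (Fin N) → ℝ} (hu : ContDiff ℝ 1 u)
    (hc : HasCompactSupport u) :
    ∫⁻ x, ENNReal.ofReal (|u x| ^ (n * (N - s) / (N - n)) * wt N k hkN ε x ^ (-s/2)) ≤
      ENNReal.ofReal ((n * (N - s) / (N - n)) / (k - s)) ^ s *
      (∫⁻ x, ENNReal.ofReal (|u x| ^ (n * N / (N - n)))) ^ (1 - s / n) *
      (∫⁻ x, ENNReal.ofReal (‖fderiv ℝ u x‖ ^ n)) ^ (s / n) := by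
  have hNn : 0 < (N:ℝ) - n := by linarith
  have hγ : 1 < n * (N - s) / (N - n) := by
    rw [lt_div_iff₀ hNn]; nlinarith
  have hcore := hardy_core hkN hε hs hγ hu hc
  have hwc := wt_continuous hkN ε
  have hwp := fun x => wt_pos hkN hε x
  have hwr : ∀ p : ℝ, Continuous fun x => wt N k hkN ε x ^ p := fun p =>
    hwc.rpow_const fun x => Or.inl (hwp x).ne'
  have huc := hu.continuous
  have hduc : Continuous (fderiv ℝ u) := hu.continuous_fderiv (by simp)
  have hint : ∀ h : EuclideanSpace ℝ (Fin N) → ℝ, Continuous h → (∀ x, u x = 0 → h x = 0) →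
      Integrable h := by
    intro h hh h0
    refine hh.integrable_of_hasCompactSupport (hc.mono ?_)
    intro x hx hx'
    exact hx (h0 x hx')
  have hN0 : (0:ℝ) < N := by linarith
  have hq : 0 < n * N / (N - n) := by positivity
  set γ := n * (N - s) / (N - n) with hγdef
  set q := n * N / (N - n) with hqdef
  have ci1 : Continuous fun x => |u x| ^ γ * wt N k hkN ε x ^ (-s/2) :=
    (huc.abs.rpow_const fun x => Or.inr (by linarith)).mul (hwr _)
  have ci2 : Continuous fun x => |u x| ^ (γ - 1) * ‖fderiv ℝ u x‖ * wt N k hkN ε x ^ (-(s-1)/2) :=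
    ((huc.abs.rpow_const fun x => Or.inr (by linarith)).mul hduc.norm).mul (hwr _)
  have ii1 : Integrable fun x => |u x| ^ γ * wt N k hkN ε x ^ (-s/2) := by
    refine hint _ ci1 fun x hx => ?_
    simp only [hx, abs_zero, Real.zero_rpow (by linarith : γ ≠ 0), zero_mul]
  have ii2 : Integrable fun x =>
      |u x| ^ (γ - 1) * ‖fderiv ℝ u x‖ * wt N k hkN ε x ^ (-(s-1)/2) := by
    refine hint _ ci2 fun x hx => ?_
    simp only [hx, abs_zero, Real.zero_rpow (by linarith : γ - 1 ≠ 0), zero_mul]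
  have n1 : ∀ x, 0 ≤ |u x| ^ γ * wt N k hkN ε x ^ (-s/2) := fun x =>
    mul_nonneg (by positivity) (Real.rpow_nonneg (hwp x).le _)
  have n2 : ∀ x, 0 ≤ |u x| ^ (γ - 1) * ‖fderiv ℝ u x‖ * wt N k hkN ε x ^ (-(s-1)/2) := fun x =>
    mul_nonneg (by positivity) (Real.rpow_nonneg (hwp x).le _)
  set A := ∫⁻ x, ENNReal.ofReal (|u x| ^ γ * wt N k hkN ε x ^ (-s/2)) with hA
  set S := ∫⁻ x, ENNReal.ofReal (|u x| ^ q) with hS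
  set G := ∫⁻ x, ENNReal.ofReal (‖fderiv ℝ u x‖ ^ n) with hG
  have eA : A = ENNReal.ofReal (∫ x, |u x| ^ γ * wt N k hkN ε x ^ (-s/2)) :=
    (ofReal_integral_eq_lintegral_ofReal ii1 (Filter.Eventually.of_forall n1)).symm
  have hAtop : A ≠ ⊤ := by rw [eA]; exact ENNReal.ofReal_ne_top
  have hks : 0 < (k:ℝ) - s := by linarith
  have h1 : A ≤ ENNReal.ofReal (γ / (k - s)) *
      ∫⁻ x, ENNReal.ofReal (|u x| ^ (γ - 1) * ‖fderiv ℝ u x‖ * wt N k hkN ε x ^ (-(s-1)/2)) := by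
    rw [← ofReal_integral_eq_lintegral_ofReal ii2 (Filter.Eventually.of_forall n2), eA,
      ← ENNReal.ofReal_mul (by positivity)]
    apply ENNReal.ofReal_le_ofReal
    rw [div_mul_eq_mul_div, le_div_iff₀ hks]
    linarith
  have hs0 : 0 < s := by linarith
  have hn0 : 0 < n := by linarith
  have hpw : ∀ x, ENNReal.ofReal (|u x| ^ (γ - 1) * ‖fderiv ℝ u x‖ * wt N k hkN ε x ^ (-(s-1)/2))
      ≤ ENNReal.ofReal (|u x| ^ γ * wt N k hkN ε x ^ (-s/2)) ^ (1 - 1/s) *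
        ENNReal.ofReal (|u x| ^ q) ^ (1/s - 1/n) * ENNReal.ofReal (‖fderiv ℝ u x‖ ^ n) ^ (1/n) := by
    intro x
    by_cases hx : u x = 0
    · simp only [hx, abs_zero, Real.zero_rpow (by linarith : γ - 1 ≠ 0), zero_mul,
        ENNReal.ofReal_zero, zero_le]
    have hs1 : 0 ≤ 1 - 1/s := by rw [sub_nonneg, div_le_one hs0]; exact hs
    have hs2 : 0 ≤ 1/s - 1/n := by rw [sub_nonneg]; gcongr
    have hux : 0 < |u x| := by positivity
    have hwx := hwp x
    rw [ENNReal.ofReal_rpow_of_nonneg (n1 x) hs1, ENNReal.ofReal_rpow_of_nonneg (by positivity) hs2,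
      ENNReal.ofReal_rpow_of_nonneg (by positivity) (by positivity),
      ← ENNReal.ofReal_mul (by positivity), ← ENNReal.ofReal_mul (by positivity)]
    apply le_of_eq
    congr 1
    rw [Real.mul_rpow (by positivity) (by positivity), ← Real.rpow_mul hux.le,
      ← Real.rpow_mul hwx.le, ← Real.rpow_mul hux.le, ← Real.rpow_mul (norm_nonneg _),
      mul_one_div_cancel hn0.ne', Real.rpow_one]
    have a1 : γ - 1 = γ * (1 - 1/s) + q * (1/s - 1/n) := by
      rw [hγdef, hqdef]; field_simp; ring
    have a2 : -(s-1)/2 = -s/2 * (1 - 1/s) := by field_simp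
    rw [a1, a2, Real.rpow_add hux]
    ring
  have m1 : AEMeasurable (fun x => ENNReal.ofReal (|u x| ^ γ * wt N k hkN ε x ^ (-s/2))) :=
    ci1.measurable.ennreal_ofReal.aemeasurable
  have m2 : AEMeasurable (fun x => ENNReal.ofReal (|u x| ^ q)) :=
    (huc.abs.rpow_const fun x => Or.inr hq.le).measurable.ennreal_ofReal.aemeasurable
  have m3 : AEMeasurable (fun x => ENNReal.ofReal (‖fderiv ℝ u x‖ ^ n)) :=
    (hduc.norm.rpow_const fun x => Or.inr hn0.le).measurable.ennreal_ofReal.aemeasurable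
  have h2 : ∫⁻ x, ENNReal.ofReal (|u x| ^ (γ - 1) * ‖fderiv ℝ u x‖ * wt N k hkN ε x ^ (-(s-1)/2))
      ≤ A ^ (1 - 1/s) * S ^ (1/s - 1/n) * G ^ (1/n) := by
    refine (lintegral_mono hpw).trans ?_
    have hs1 : 0 ≤ 1 - 1/s := by rw [sub_nonneg, div_le_one hs0]; exact hs
    have hs2 : 0 ≤ 1/s - 1/n := by rw [sub_nonneg]; gcongr
    have := ENNReal.lintegral_prod_norm_pow_le (μ := volume) (Finset.univ : Finset (Fin 3))
      (f := ![fun x => ENNReal.ofReal (|u x| ^ γ * wt N k hkN ε x ^ (-s/2)),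
        fun x => ENNReal.ofReal (|u x| ^ q), fun x => ENNReal.ofReal (‖fderiv ℝ u x‖ ^ n)])
      (p := ![1 - 1/s, 1/s - 1/n, 1/n])
      (by intro i _; fin_cases i <;> [exact m1; exact m2; exact m3])
      (by simp [Fin.sum_univ_three])
      (by intro i _; fin_cases i <;> [exact hs1; exact hs2; exact (by positivity : 0 ≤ 1/n)])
    simp only [Fin.prod_univ_three] at this
    exact this
  by_cases hA0 : A = 0
  · rw [hA0]; exact zero_le
  have h3 := h1.trans (mul_le_mul_right h2 _)
  have h4 : A ^ (1/s) ≤ ENNReal.ofReal (γ / (k - s)) * (S ^ (1/s - 1/n) * G ^ (1/n)) := by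
    have hA1 : A ^ (1 - 1/s) ≠ 0 := by simp [ENNReal.rpow_eq_zero_iff, hA0, hAtop]
    have hA2 : A ^ (1 - 1/s) ≠ ⊤ := by simp [ENNReal.rpow_eq_top_iff, hA0, hAtop]
    rw [← ENNReal.mul_le_mul_iff_right hA1 hA2, ← ENNReal.rpow_add _ _ hA0 hAtop,
      sub_add_cancel, ENNReal.rpow_one]
    refine h3.trans (le_of_eq ?_)
    ring
  have h5 := ENNReal.rpow_le_rpow h4 hs0.le
  rw [← ENNReal.rpow_mul, one_div_mul_cancel hs0.ne', ENNReal.rpow_one,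
    ENNReal.mul_rpow_of_nonneg _ _ hs0.le, ENNReal.mul_rpow_of_nonneg _ _ hs0.le,
    ← ENNReal.rpow_mul, ← ENNReal.rpow_mul, ← mul_assoc] at h5
  have a1 : (1/s - 1/n) * s = 1 - s/n := by field_simp
  have a2 : 1/n * s = s/n := by ring
  rwa [a1, a2] at h5

lemma gns (N : ℕ) (n : ℝ) (hn1 : 1 < n) (hnN : n < N) : ∃ K : NNReal,
    ∀ u : EuclideanSpace ℝ (Fin N) → ℝ, ContDiff ℝ 1 u → HasCompactSupport u →
    ∫⁻ x, ENNReal.ofReal (|u x| ^ (n * N / (N - n))) ≤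
      K * (∫⁻ x, ENNReal.ofReal (‖fderiv ℝ u x‖ ^ n)) ^ (N / (N - n)) := by
  have hNn : 0 < (N:ℝ) - n := by linarith
  have hn0 : 0 < n := by linarith
  have hN0 : (0:ℝ) < N := by linarith
  have hq : 0 < n * N / (N - n) := by positivity
  set q := n * N / (N - n) with hqdef
  let p : NNReal := ⟨n, hn0.le⟩
  let p' : NNReal := ⟨q, hq.le⟩
  refine ⟨SNormLESNormFDerivOfEqConst ℝ (volume : Measure (EuclideanSpace ℝ (Fin N))) p ^ q,
    fun u hu hc => ?_⟩
  have h := eLpNorm_le_eLpNorm_fderiv_of_eq (μ := volume) hu hc (p := p) (p' := p')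
    (by exact_mod_cast hn1.le) (by simp; exact_mod_cast hN0) (by
      rw [finrank_euclideanSpace, Fintype.card_fin]
      change q⁻¹ = n⁻¹ - (N:ℝ)⁻¹
      rw [hqdef]; field_simp)
  have e1 : (p : ENNReal).toReal = n := rfl
  have e2 : (p' : ENNReal).toReal = q := rfl
  have z1 : (p : ENNReal) ≠ 0 := by
    intro h0; rw [h0] at e1; simp at e1; linarith
  have z2 : (p' : ENNReal) ≠ 0 := by
    intro h0; rw [h0] at e2; simp at e2; linarith
  rw [eLpNorm_eq_lintegral_rpow_enorm_toReal z1 ENNReal.coe_ne_top,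
    eLpNorm_eq_lintegral_rpow_enorm_toReal z2 ENNReal.coe_ne_top, e1, e2] at h
  have h5 := ENNReal.rpow_le_rpow h hq.le
  rw [← ENNReal.rpow_mul, one_div_mul_cancel hq.ne', ENNReal.rpow_one,
    ENNReal.mul_rpow_of_nonneg _ _ hq.le, ← ENNReal.rpow_mul] at h5
  have a1 : 1 / n * q = N / (N - n) := by rw [hqdef]; field_simp
  rw [a1, ← ENNReal.coe_rpow_of_nonneg _ hq.le] at h5
  have c1 : ∀ x, ‖u x‖ₑ ^ q = ENNReal.ofReal (|u x| ^ q) := fun x => by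
    rw [← ofReal_norm, ENNReal.ofReal_rpow_of_nonneg (norm_nonneg _) hq.le,
      Real.norm_eq_abs]
  have c2 : ∀ x, ‖fderiv ℝ u x‖ₑ ^ n = ENNReal.ofReal (‖fderiv ℝ u x‖ ^ n) := fun x => by
    rw [← ofReal_norm, ENNReal.ofReal_rpow_of_nonneg (norm_nonneg _) hn0.le]
  simpa only [c1, c2] using h5

lemma hs_ge_one {N k : ℕ} (hkN : k ≤ N) {s n : ℝ} (hs : 1 ≤ s)
    (hsn : s ≤ n) (hn1 : 1 < n) (hnN : n < N) (hsk : s < k) : ∃ K : ENNReal, K ≠ ⊤ ∧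
    ∀ ε : ℝ, 0 < ε → ∀ u : EuclideanSpace ℝ (Fin N) → ℝ, ContDiff ℝ 1 u → HasCompactSupport u →
    ∫⁻ x, ENNReal.ofReal (|u x| ^ (n * (N - s) / (N - n)) * wt N k hkN ε x ^ (-s/2)) ≤
      K * (∫⁻ x, ENNReal.ofReal (‖fderiv ℝ u x‖ ^ n)) ^ ((N - s) / (N - n)) := by
  obtain ⟨K, hK⟩ := gns N n hn1 hnN
  have hNn : 0 < (N:ℝ) - n := by linarith
  have hn0 : 0 < n := by linarith
  have hN0 : (0:ℝ) < N := by linarith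
  have hs0 : 0 < s := by linarith
  have hsn' : 0 ≤ 1 - s / n := by rw [sub_nonneg, div_le_one hn0]; exact hsn
  refine ⟨ENNReal.ofReal ((n * (N - s) / (N - n)) / (k - s)) ^ s * (K:ENNReal) ^ (1 - s / n), ?_, ?_⟩
  · exact ENNReal.mul_ne_top (ENNReal.rpow_ne_top_of_nonneg hs0.le ENNReal.ofReal_ne_top)
      (ENNReal.rpow_ne_top_of_nonneg hsn' ENNReal.coe_ne_top)
  intro ε hε u hu hc
  refine (hardy_step hkN hε hs hsn hn1 hnN hsk hu hc).trans ?_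
  have h := ENNReal.rpow_le_rpow (hK u hu hc) hsn'
  rw [ENNReal.mul_rpow_of_nonneg _ _ hsn', ← ENNReal.rpow_mul] at h
  have a : ((N:ℝ) - s) / (N - n) = N / (N - n) * (1 - s / n) + s / n := by field_simp; ring
  rw [a, ENNReal.rpow_add_of_nonneg _ _ (by positivity) (by positivity)]
  refine (mul_le_mul_left (mul_le_mul_right h _) _).trans (le_of_eq ?_)
  ring

lemma hs_all {N k : ℕ} (hk2 : 2 ≤ k) (hkN : k ≤ N) {s n : ℝ} (hs : 0 ≤ s)
    (hsn : s ≤ n) (hn1 : 1 < n) (hnN : n < N) (hsk : s < k) : ∃ K : ENNReal, K ≠ ⊤ ∧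
    ∀ ε : ℝ, 0 < ε → ∀ u : EuclideanSpace ℝ (Fin N) → ℝ, ContDiff ℝ 1 u → HasCompactSupport u →
    ∫⁻ x, ENNReal.ofReal (|u x| ^ (n * (N - s) / (N - n)) * wt N k hkN ε x ^ (-s/2)) ≤
      K * (∫⁻ x, ENNReal.ofReal (‖fderiv ℝ u x‖ ^ n)) ^ ((N - s) / (N - n)) := by
  rcases le_or_gt 1 s with h1 | h1
  · exact hs_ge_one hkN h1 hsn hn1 hnN hsk
  have hk1 : (1:ℝ) < k := by exact_mod_cast hk2
  obtain ⟨K, hK⟩ := gns N n hn1 hnN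
  obtain ⟨K1, hK1t, hK1⟩ := hs_ge_one hkN le_rfl hn1.le hn1 hnN hk1
  have hNn : 0 < (N:ℝ) - n := by linarith
  have hn0 : 0 < n := by linarith
  have hN0 : (0:ℝ) < N := by linarith
  have hN1 : (0:ℝ) < N - 1 := by linarith
  have hs1 : 0 ≤ 1 - s := by linarith
  refine ⟨K1 ^ s * (K:ENNReal) ^ (1 - s), ?_, ?_⟩
  · exact ENNReal.mul_ne_top (ENNReal.rpow_ne_top_of_nonneg hs hK1t)
      (ENNReal.rpow_ne_top_of_nonneg hs1 ENNReal.coe_ne_top)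
  intro ε hε u hu hc
  have hwp := fun x => wt_pos hkN hε x
  have huc := hu.continuous
  have hγ1 : 0 ≤ n * (N - 1) / (N - n) := by positivity
  have hq : 0 ≤ n * N / (N - n) := by positivity
  have hγ : 0 < n * (N - s) / (N - n) := by
    have : (0:ℝ) < N - s := by linarith
    positivity
  calc ∫⁻ x, ENNReal.ofReal (|u x| ^ (n * (N - s) / (N - n)) * wt N k hkN ε x ^ (-s/2))
      ≤ ∫⁻ x, ENNReal.ofReal (|u x| ^ (n * (N - 1) / (N - n)) * wt N k hkN ε x ^ (-(1:ℝ)/2)) ^ s *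
          ENNReal.ofReal (|u x| ^ (n * N / (N - n))) ^ (1 - s) := by
        refine lintegral_mono fun x => ?_
        by_cases hx : u x = 0
        · simp only [hx, abs_zero, Real.zero_rpow hγ.ne', zero_mul, ENNReal.ofReal_zero, zero_le]
        have hux : 0 < |u x| := by positivity
        have hwx := hwp x
        rw [ENNReal.ofReal_rpow_of_nonneg (by positivity) hs,
          ENNReal.ofReal_rpow_of_nonneg (by positivity) hs1, ← ENNReal.ofReal_mul (by positivity)]
        apply le_of_eq
        congr 1
        rw [Real.mul_rpow (by positivity) (by positivity), ← Real.rpow_mul hux.le,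
          ← Real.rpow_mul hwx.le, ← Real.rpow_mul hux.le]
        have a1 : n * (N - s) / (N - n) =
            n * (N - 1) / (N - n) * s + n * N / (N - n) * (1 - s) := by field_simp; ring
        have a2 : -s/2 = -(1:ℝ)/2 * s := by ring
        rw [a1, a2, Real.rpow_add hux]
        ring
    _ ≤ (∫⁻ x, ENNReal.ofReal (|u x| ^ (n * (N - 1) / (N - n)) * wt N k hkN ε x ^ (-(1:ℝ)/2))) ^ s *
          (∫⁻ x, ENNReal.ofReal (|u x| ^ (n * N / (N - n)))) ^ (1 - s) := by
        refine ENNReal.lintegral_mul_norm_pow_le ?_ ?_ hs hs1 (by ring)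
        · exact ((huc.abs.rpow_const fun x => Or.inr hγ1).mul ((wt_continuous hkN ε).rpow_const
            fun x => Or.inl (hwp x).ne')).measurable.ennreal_ofReal.aemeasurable
        · exact (huc.abs.rpow_const fun x => Or.inr hq).measurable.ennreal_ofReal.aemeasurable
    _ ≤ (K1 * (∫⁻ x, ENNReal.ofReal (‖fderiv ℝ u x‖ ^ n)) ^ (((N:ℝ) - 1) / (N - n))) ^ s *
          (K * (∫⁻ x, ENNReal.ofReal (‖fderiv ℝ u x‖ ^ n)) ^ ((N:ℝ) / (N - n))) ^ (1 - s) :=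
        mul_le_mul' (ENNReal.rpow_le_rpow (hK1 ε hε u hu hc) hs)
          (ENNReal.rpow_le_rpow (hK u hu hc) hs1)
    _ = _ := by
        have a : ((N:ℝ) - s) / (N - n) = (N - 1) / (N - n) * s + N / (N - n) * (1 - s) := by
          field_simp; ring
        rw [a, ENNReal.rpow_add_of_nonneg _ _ (by positivity) (by positivity),
          ENNReal.mul_rpow_of_nonneg _ _ hs, ENNReal.mul_rpow_of_nonneg _ _ hs1,
          ← ENNReal.rpow_mul, ← ENNReal.rpow_mul]
        ring

/-- Hardy–Sobolev inequality. -/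
theorem hardy_sobolev_inequality (N k : ℕ) (hk2 : 2 ≤ k) (hkN : k ≤ N) (n β : ℝ)
    (hn1 : 1 < n) (hnN : n < (N : ℝ)) (hβ0 : 0 ≤ β) (hβn : β ≤ n) (hβk : β < (k : ℝ)) :
    ∃ C > 0, ∀ u : EuclideanSpace ℝ (Fin N) → ℝ, ContDiff ℝ (⊤ : ℕ∞) u → HasCompactSupport u →
      ∫⁻ x, ENNReal.ofReal (|u x| ^ (n * ((N : ℝ) - β) / ((N : ℝ) - n)) /
          Real.sqrt (∑ i : Fin k, x (Fin.castLE hkN i) ^ 2) ^ β) ≤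
        ENNReal.ofReal
          (C * (∫ x, ‖fderiv ℝ u x‖ ^ n) ^ (((N : ℝ) - β) / ((N : ℝ) - n))) := by
  obtain ⟨K, hKt, hK⟩ := hs_all hk2 hkN hβ0 hβn hn1 hnN hβk
  have hNn : 0 < (N:ℝ) - n := by linarith
  have hn0 : 0 < n := by linarith
  have hNβ : (0:ℝ) < N - β := by linarith
  have hγ : 0 < n * ((N:ℝ) - β) / (N - n) := by positivity
  refine ⟨K.toReal + 1, by positivity, fun u hu' hc => ?_⟩
  have hu : ContDiff ℝ 1 u := hu'.of_le (by exact_mod_cast le_top)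
  have huc := hu.continuous
  have hduc : Continuous (fderiv ℝ u) := hu.continuous_fderiv (by simp)
  have hint : Integrable (fun x => ‖fderiv ℝ u x‖ ^ n) := by
    refine (hduc.norm.rpow_const fun x => Or.inr hn0.le).integrable_of_hasCompactSupport
      ((hc.fderiv ℝ).mono ?_)
    intro x hx hx'
    apply hx
    simp only [hx', norm_zero, Real.zero_rpow hn0.ne']
  have hG := ofReal_integral_eq_lintegral_ofReal hint
    (Filter.Eventually.of_forall fun x => by positivity)
  have hI : 0 ≤ ∫ x, ‖fderiv ℝ u x‖ ^ n := integral_nonneg fun x => by positivity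
  have hεpos : ∀ m : ℕ, (0:ℝ) < 1 / ((m:ℝ) + 1) := fun m => by positivity
  have hcont : ∀ m : ℕ, Continuous fun x => |u x| ^ (n * ((N : ℝ) - β) / ((N : ℝ) - n)) *
      wt N k hkN (1 / ((m:ℝ) + 1)) x ^ (-β/2) := fun m =>
    (huc.abs.rpow_const fun x => Or.inr hγ.le).mul ((wt_continuous hkN _).rpow_const
      fun x => Or.inl (wt_pos hkN (hεpos m) x).ne')
  calc _ ≤ ∫⁻ x, Filter.liminf (fun m : ℕ => ENNReal.ofReal
          (|u x| ^ (n * ((N : ℝ) - β) / ((N : ℝ) - n)) *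
            wt N k hkN (1 / ((m:ℝ) + 1)) x ^ (-β/2))) Filter.atTop := by
        refine lintegral_mono fun x => ?_
        set r := ∑ i : Fin k, x (Fin.castLE hkN i) ^ 2 with hr
        have hr0 : 0 ≤ r := by positivity
        have hsq : Real.sqrt r ^ β = r ^ (β/2) := by
          rw [Real.sqrt_eq_rpow, ← Real.rpow_mul hr0]; ring_nf
        rw [hsq]
        by_cases hcase : r = 0 ∧ β ≠ 0
        · have : r ^ (β/2) = 0 := by
            rw [hcase.1, Real.zero_rpow (div_ne_zero hcase.2 two_ne_zero)]
          rw [this, div_zero, ENNReal.ofReal_zero]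
          exact zero_le
        · have ht : Filter.Tendsto (fun m : ℕ => wt N k hkN (1 / ((m:ℝ) + 1)) x ^ (-β/2))
              Filter.atTop (nhds (r ^ (-β/2))) := by
            have h0 : Filter.Tendsto (fun m : ℕ => wt N k hkN (1 / ((m:ℝ) + 1)) x)
                Filter.atTop (nhds r) := by
              have := (tendsto_one_div_add_atTop_nhds_zero_nat (𝕜 := ℝ)).const_add r
              rw [add_zero] at this
              exact this
            by_cases hβz : β = 0
            · simp [hβz]
            · exact h0.rpow_const (Or.inl fun h => hcase ⟨h, hβz⟩)
          have ht2 := ENNReal.tendsto_ofReal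
            (ht.const_mul (|u x| ^ (n * ((N : ℝ) - β) / ((N : ℝ) - n))))
          rw [ht2.liminf_eq, neg_div, Real.rpow_neg hr0, div_eq_mul_inv]
    _ ≤ Filter.liminf (fun m : ℕ => ∫⁻ x, ENNReal.ofReal
          (|u x| ^ (n * ((N : ℝ) - β) / ((N : ℝ) - n)) *
            wt N k hkN (1 / ((m:ℝ) + 1)) x ^ (-β/2))) Filter.atTop :=
        lintegral_liminf_le fun m => (hcont m).measurable.ennreal_ofReal
    _ ≤ Filter.liminf (fun _ : ℕ => K * (∫⁻ x, ENNReal.ofReal (‖fderiv ℝ u x‖ ^ n)) ^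
          (((N:ℝ) - β) / (N - n))) Filter.atTop :=
        Filter.liminf_le_liminf (Filter.Eventually.of_forall fun m => hK _ (hεpos m) u hu hc)
    _ = K * (∫⁻ x, ENNReal.ofReal (‖fderiv ℝ u x‖ ^ n)) ^ (((N:ℝ) - β) / (N - n)) :=
        Filter.liminf_const _
    _ ≤ _ := by
        rw [← hG, ENNReal.ofReal_rpow_of_nonneg hI (by positivity),
          ENNReal.ofReal_mul (by positivity)]
        gcongr
        rw [← ENNReal.ofReal_toReal hKt]
        apply ENNReal.ofReal_le_ofReal
        simp
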